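/- arXiv:2011.06834 — 4 statements merged into one kernel-verified Lean document; each statement's English description precedes it below -/
import Mathlib

section
/- Let 1 < q < ∞ and q* = q/(q−1). Then for all x ∈ [0, π_{q/2,q}/2), cosh_{2,q}(2^{2/q} x) = (cosh_{q*,q}(x))^{q*} + (sinh_{q*,q}(x))^q. -/
open MeasureTheory Set
open scoped ENNReal

/-- `genF p q y = ∫_0^y (1 - t^q)^(-1/p) dt`, whose inverse is the generalized sine. -/
noncomputable def genF (p q y : ℝ) : ℝ := ∫ t in (0:ℝ)..y, (1 - t ^ q) ^ (-(1 / p))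

/-- `genG p q y = ∫_0^y (1 + t^q)^(-1/p) dt`, whose inverse is the generalized hyperbolic sine. -/
noncomputable def genG (p q y : ℝ) : ℝ := ∫ t in (0:ℝ)..y, (1 + t ^ q) ^ (-(1 / p))

/-- The generalized π, `π_{p,q} = 2∫_0^1 (1 - t^q)^(-1/p) dt`, as an extended real number
(it is `∞` when `q/(q+1) < p ≤ 1`). -/
noncomputable def genPi (p q : ℝ) : ℝ≥0∞ :=
  2 * ∫⁻ t in Ioo (0:ℝ) 1, ENNReal.ofReal ((1 - t ^ q) ^ (-(1 / p)))

/-- The generalized sine `sin_{p,q}`: the inverse of `genF p q`, which maps `[0,1)` onto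
`[0, π_{p,q}/2)`. -/
noncomputable def gsin (p q : ℝ) : ℝ → ℝ := Function.invFunOn (genF p q) (Ico 0 1)

/-- The generalized cosine `cos_{p,q} x = (d/dx) sin_{p,q} x` (one-sided at `x = 0`). -/
noncomputable def gcos (p q x : ℝ) : ℝ := derivWithin (gsin p q) (Ici 0) x

/-- The generalized hyperbolic sine `sinh_{p,q}`: the inverse of `genG p q`, which maps
`[0,∞)` onto `[0, π_{r,q}/2)` where `r = pq/(pq+p-q)`. -/
noncomputable def gsinh (p q : ℝ) : ℝ → ℝ := Function.invFunOn (genG p q) (Ici 0)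

/-- The generalized hyperbolic cosine `cosh_{p,q} x = (d/dx) sinh_{p,q} x`
(one-sided at `x = 0`). -/
noncomputable def gcosh (p q x : ℝ) : ℝ := derivWithin (gsinh p q) (Ici 0) x

theorem continuous_one_add_abs_rpow_rpow {q : ℝ} (hq : 0 < q) (a : ℝ) :
    Continuous fun t : ℝ => (1 + |t| ^ q) ^ a := by
  refine Continuous.rpow_const ?_ fun t => Or.inl ?_
  · exact continuous_const.add (continuous_abs.rpow_const fun _ => Or.inr hq.le)
  · positivity

theorem genG_eq_integral_abs (p q : ℝ) {y : ℝ} (hy : 0 ≤ y) :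
    genG p q y = ∫ t in (0:ℝ)..y, (1 + |t| ^ q) ^ (-(1 / p)) := by
  refine intervalIntegral.integral_congr fun t ht => ?_
  rw [uIcc_of_le hy] at ht
  simp only [abs_of_nonneg ht.1]

theorem hasStrictDerivAt_integral_one_add_abs_rpow {q : ℝ} (hq : 0 < q) (a y : ℝ) :
    HasStrictDerivAt (fun y => ∫ t in (0:ℝ)..y, (1 + |t| ^ q) ^ a) ((1 + |y| ^ q) ^ a) y :=
  (continuous_one_add_abs_rpow_rpow hq a).integral_hasStrictDerivAt 0 y

theorem strictMono_integral_one_add_abs_rpow {q : ℝ} (hq : 0 < q) (a : ℝ) :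
    StrictMono fun y => ∫ t in (0:ℝ)..y, (1 + |t| ^ q) ^ a := by
  refine strictMono_of_deriv_pos fun y => ?_
  rw [(hasStrictDerivAt_integral_one_add_abs_rpow hq a y).hasDerivAt.deriv]
  positivity

theorem genG_injOn (p : ℝ) {q : ℝ} (hq : 0 < q) : InjOn (genG p q) (Ici 0) := by
  intro a ha b hb hab
  rw [genG_eq_integral_abs p q ha, genG_eq_integral_abs p q hb] at hab
  exact (strictMono_integral_one_add_abs_rpow hq _).injective hab

theorem gsinh_genG (p : ℝ) {q s : ℝ} (hq : 0 < q) (hs : 0 ≤ s) :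
    gsinh p q (genG p q s) = s :=
  (genG_injOn p hq).leftInvOn_invFunOn hs

theorem genG_nonneg (p : ℝ) {q s : ℝ} (hs : 0 ≤ s) : 0 ≤ genG p q s := by
  rw [genG_eq_integral_abs p q hs]
  exact intervalIntegral.integral_nonneg hs fun t _ => by positivity

theorem gcosh_genG (p : ℝ) {q s : ℝ} (hq : 0 < q) (hs : 0 ≤ s) :
    gcosh p q (genG p q s) = (1 + s ^ q) ^ (1 / p) := by
  set G : ℝ → ℝ := fun y => ∫ t in (0:ℝ)..y, (1 + |t| ^ q) ^ (-(1 / p)) with hG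
  have hmono : StrictMono G := strictMono_integral_one_add_abs_rpow hq _
  have hG0 : G 0 = 0 := by simp [hG]
  have hGs : genG p q s = G s := genG_eq_integral_abs p q hs
  have hpos : 0 < (1 + |s| ^ q) ^ (-(1 / p)) := by positivity
  have hd := hasStrictDerivAt_integral_one_add_abs_rpow hq (-(1 / p)) s
  have hinv := (hd.to_localInverse hpos.ne').hasDerivAt
  have hright := (hd.hasStrictFDerivAt_equiv hpos.ne').eventually_right_inverse
  have heq : ∀ z, 0 ≤ z → ∀ w, G w = z → gsinh p q z = w := by
    intro z hz w hw
    have hw0 : 0 ≤ w := by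
      rw [← hmono.le_iff_le, hG0, hw]
      exact hz
    rw [← hw, show G w = genG p q w from (genG_eq_integral_abs p q hw0).symm]
    exact gsinh_genG p hq hw0
  rw [gcosh, hGs]
  have hx0 : 0 ≤ G s := hGs ▸ genG_nonneg p hs
  have hder := hinv.hasDerivWithinAt (s := Ici 0)
  have hder' := hder.congr_of_eventuallyEq (f₁ := gsinh p q)
    (by
      filter_upwards [nhdsWithin_le_nhds hright, self_mem_nhdsWithin] with z hz hz0
      exact heq z hz0 _ hz)
    (heq _ hx0 _ hright.self_of_nhds)
  rw [hder'.derivWithin (uniqueDiffOn_Ici 0 _ hx0), abs_of_nonneg hs,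
    Real.rpow_neg (by positivity), inv_inv]

theorem genG_two_eq {q s : ℝ} (hq : 1 < q) (hs : 0 ≤ s) :
    genG 2 q ((2:ℝ) ^ (2 / q) * (s * (1 + s ^ q) ^ (1 / q))) =
      (2:ℝ) ^ (2 / q) * genG (q / (q - 1)) q s := by
  have hq0 : 0 < q := by linarith
  set c : ℝ := (2:ℝ) ^ (2 / q) with hc
  have hcpos : 0 < c := by positivity
  have hcq : c ^ q = 4 := by
    rw [hc, ← Real.rpow_mul (by norm_num), div_mul_cancel₀ _ hq0.ne']
    norm_num
  have hbase : Continuous fun t : ℝ => 1 + |t| ^ q :=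
    continuous_const.add (continuous_abs.rpow_const fun _ => Or.inr hq0.le)
  set f : ℝ → ℝ := fun t => c * (t * (1 + t ^ q) ^ (1 / q)) with hf
  set f' : ℝ → ℝ := fun t => c * ((1 + 2 * t ^ q) * (1 + t ^ q) ^ (1 / q - 1)) with hf'
  have hcont : ∀ a : ℝ, ContinuousOn (fun t : ℝ => (1 + t ^ q) ^ a) (uIcc 0 s) := by
    intro a
    refine (continuous_one_add_abs_rpow_rpow hq0 a).continuousOn.congr fun t ht => ?_
    rw [uIcc_of_le hs] at ht
    simp only [abs_of_nonneg ht.1]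
  have hkey := intervalIntegral.integral_comp_mul_deriv'' (a := 0) (b := s) (f := f) (f' := f')
    (g := fun t => (1 + |t| ^ q) ^ (-(1 / 2 : ℝ)))
    (continuousOn_const.mul (continuousOn_id.mul (hcont _)))
    (by
      intro t ht
      rw [min_eq_left hs, max_eq_right hs] at ht
      have ht0 : 0 < t := ht.1
      have htq : 0 < 1 + t ^ q := by positivity
      have h1 : HasDerivAt (fun t : ℝ => 1 + t ^ q) (q * t ^ (q - 1)) t :=
        (Real.hasDerivAt_rpow_const (Or.inl ht0.ne')).const_add 1
      have h2 := ((hasDerivAt_id t).mul (h1.rpow_const (p := 1 / q) (Or.inl htq.ne'))).const_mul c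
      refine (h2.congr_deriv ?_).hasDerivWithinAt
      simp only [hf', id]
      have e1 : (1 + t ^ q) ^ (1 / q) = (1 + t ^ q) ^ (1 / q - 1) * (1 + t ^ q) := by
        rw [Real.rpow_sub_one htq.ne', div_mul_cancel₀ _ htq.ne']
      have e2 : t ^ q = t ^ (q - 1) * t := by
        rw [Real.rpow_sub_one ht0.ne', div_mul_cancel₀ _ ht0.ne']
      rw [e1]
      generalize (1 + t ^ q) ^ (1 / q - 1) = A
      rw [e2]
      field_simp
      ring)
    (continuousOn_const.mul (((continuousOn_const.add
      (continuousOn_const.mul (continuousOn_id.rpow_const fun _ _ => Or.inr hq0.le)))).mul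
        (hcont _)))
    (continuous_one_add_abs_rpow_rpow hq0 _).continuousOn
  have hf0 : f 0 = 0 := by simp [hf]
  have hfs : 0 ≤ f s := by simp only [hf]; positivity
  rw [hf0] at hkey
  change genG 2 q (f s) = _
  rw [genG_eq_integral_abs 2 q hfs, ← hkey, genG, ← intervalIntegral.integral_const_mul]
  refine intervalIntegral.integral_congr fun t ht => ?_
  rw [uIcc_of_le hs] at ht
  have ht0 : 0 ≤ t := ht.1
  have htq : 0 < 1 + t ^ q := by positivity
  have hft : 0 ≤ f t := by simp only [hf]; positivity
  have hsq : 1 + |f t| ^ q = (1 + 2 * t ^ q) ^ (2 : ℝ) := by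
    rw [abs_of_nonneg hft]
    simp only [hf]
    rw [Real.mul_rpow hcpos.le (by positivity), Real.mul_rpow ht0 (by positivity), hcq,
      ← Real.rpow_mul htq.le, one_div_mul_cancel hq0.ne', Real.rpow_one, Real.rpow_two]
    ring
  have hexp : -(1 / (q / (q - 1))) = 1 / q - 1 := by
    field_simp
    ring
  simp only [Function.comp, hf']
  have hpos2 : 0 < 1 + 2 * t ^ q := by positivity
  rw [hsq, ← Real.rpow_mul hpos2.le, hexp, show (2:ℝ) * -(1 / 2) = -1 by norm_num,
    Real.rpow_neg_one]
  field_simp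

theorem genG_conj_eq_genF {q c : ℝ} (hq : 1 < q) (hc0 : 0 ≤ c) (hc1 : c < 1) :
    genG (q / (q - 1)) q (c * (1 - c ^ q) ^ (-(1 / q))) = genF (q / 2) q c := by
  have hq0 : 0 < q := by linarith
  have hlt : ∀ t ∈ Icc 0 c, 0 < 1 - t ^ q := fun t ht =>
    sub_pos.2 (Real.rpow_lt_one ht.1 (ht.2.trans_lt hc1) hq0)
  set f : ℝ → ℝ := fun t => t * (1 - t ^ q) ^ (-(1 / q)) with hf
  set f' : ℝ → ℝ := fun t => (1 - t ^ q) ^ (-(1 / q) - 1) with hf'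
  have hcont : ∀ a : ℝ, ContinuousOn (fun t : ℝ => (1 - t ^ q) ^ a) (uIcc 0 c) := by
    intro a
    rw [uIcc_of_le hc0]
    exact (continuousOn_const.sub (continuousOn_id.rpow_const fun _ _ => Or.inr hq0.le)).rpow_const
      fun t ht => Or.inl (hlt t ht).ne'
  have hkey := intervalIntegral.integral_comp_mul_deriv'' (a := 0) (b := c) (f := f) (f' := f')
    (g := fun t => (1 + |t| ^ q) ^ (-(1 / (q / (q - 1)))))
    (continuousOn_id.mul (hcont _))
    (by
      intro t ht
      rw [min_eq_left hc0, max_eq_right hc0] at ht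
      have ht0 : 0 < t := ht.1
      have htq : 0 < 1 - t ^ q := hlt t ⟨ht.1.le, ht.2.le⟩
      have h1 : HasDerivAt (fun t : ℝ => 1 - t ^ q) (-(q * t ^ (q - 1))) t :=
        (Real.hasDerivAt_rpow_const (Or.inl ht0.ne')).const_sub 1
      have h2 := (hasDerivAt_id t).mul (h1.rpow_const (p := -(1 / q)) (Or.inl htq.ne'))
      refine (h2.congr_deriv ?_).hasDerivWithinAt
      simp only [hf', id]
      have e1 : (1 - t ^ q) ^ (-(1 / q)) = (1 - t ^ q) ^ (-(1 / q) - 1) * (1 - t ^ q) := by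
        rw [Real.rpow_sub_one htq.ne', div_mul_cancel₀ _ htq.ne']
      have e2 : t ^ q = t ^ (q - 1) * t := by
        rw [Real.rpow_sub_one ht0.ne', div_mul_cancel₀ _ ht0.ne']
      rw [e1]
      generalize (1 - t ^ q) ^ (-(1 / q) - 1) = A
      rw [e2]
      field_simp
      ring)
    (hcont _)
    (continuous_one_add_abs_rpow_rpow hq0 _).continuousOn
  have hf0 : f 0 = 0 := by simp [hf]
  have hfnn : ∀ t ∈ Icc 0 c, 0 ≤ f t := fun t ht =>
    mul_nonneg ht.1 (Real.rpow_nonneg (hlt t ht).le _)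
  rw [hf0] at hkey
  change genG _ q (f c) = _
  rw [genG_eq_integral_abs _ q (hfnn c ⟨hc0, le_rfl⟩), ← hkey, genF]
  refine intervalIntegral.integral_congr fun t ht => ?_
  rw [uIcc_of_le hc0] at ht
  have htq := hlt t ht
  have hinv : 1 + |f t| ^ q = (1 - t ^ q) ^ (-1 : ℝ) := by
    rw [abs_of_nonneg (hfnn t ht)]
    simp only [hf]
    rw [Real.mul_rpow ht.1 (Real.rpow_nonneg htq.le _), ← Real.rpow_mul htq.le,
      show -(1 / q) * q = -1 by field_simp, Real.rpow_neg_one]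
    field_simp
    ring
  simp only [Function.comp, hf']
  rw [hinv, ← Real.rpow_mul htq.le, ← Real.rpow_add htq]
  congr 1
  field_simp
  ring

theorem exists_lt_genF_of_lt_genPi {p q x : ℝ} (hq : 0 < q)
    (hx : ENNReal.ofReal x < genPi p q / 2) : ∃ c, 0 ≤ c ∧ c < 1 ∧ x < genF p q c := by
  rw [genPi, mul_comm, ENNReal.mul_div_cancel_right (by norm_num) (by norm_num)] at hx
  set u : ℕ → ℝ := fun n => 1 - 1 / ((n : ℝ) + 1) with hu
  have hu0 : ∀ n, 0 ≤ u n := fun n => by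
    have : 1 / ((n : ℝ) + 1) ≤ 1 := by
      rw [div_le_one (by positivity)]
      linarith [(Nat.cast_nonneg n : (0:ℝ) ≤ n)]
    simp only [hu]
    linarith
  have hu1 : ∀ n, u n < 1 := fun n => by
    have : 0 < 1 / ((n : ℝ) + 1) := by positivity
    simp only [hu]
    linarith
  have hum : Monotone u := fun m n hmn => by
    have := Nat.one_div_le_one_div (α := ℝ) hmn
    simp only [hu]
    linarith
  have hunion : Ioo (0:ℝ) 1 = ⋃ n, Ioc 0 (u n) := by
    ext t
    simp only [mem_Ioo, mem_iUnion, mem_Ioc]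
    constructor
    · rintro ⟨h0, h1⟩
      obtain ⟨n, hn⟩ := exists_nat_one_div_lt (sub_pos.2 h1)
      exact ⟨n, h0, by simp only [hu]; linarith⟩
    · rintro ⟨n, h0, h1⟩
      exact ⟨h0, h1.trans_lt (hu1 n)⟩
  have hdir : Directed (· ⊆ ·) fun n => Ioc 0 (u n) :=
    Monotone.directed_le fun m n hmn => Ioc_subset_Ioc_right (hum hmn)
  rw [hunion, setLIntegral_iUnion_of_directed _ hdir, lt_iSup_iff] at hx
  obtain ⟨n, hn⟩ := hx
  refine ⟨u n, hu0 n, hu1 n, ?_⟩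
  have hlt : ∀ t ∈ Icc 0 (u n), 0 < 1 - t ^ q := fun t ht =>
    sub_pos.2 (Real.rpow_lt_one ht.1 (ht.2.trans_lt (hu1 n)) hq)
  have hint : IntegrableOn (fun t : ℝ => (1 - t ^ q) ^ (-(1 / p))) (Ioc 0 (u n)) := by
    refine (ContinuousOn.integrableOn_Icc ?_).mono_set Ioc_subset_Icc_self
    exact (continuousOn_const.sub (continuousOn_id.rpow_const fun _ _ => Or.inr hq.le)).rpow_const
      fun t ht => Or.inl (hlt t ht).ne'
  rw [← ofReal_integral_eq_lintegral_ofReal hint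
    ((ae_restrict_mem measurableSet_Ioc).mono fun t ht =>
      Real.rpow_nonneg (hlt t (Ioc_subset_Icc_self ht)).le _)] at hn
  rw [genF, intervalIntegral.integral_of_le (hu0 n)]
  exact (ENNReal.ofReal_lt_ofReal_iff'.1 hn).1

theorem exists_genG_conj_eq {q x : ℝ} (hq : 1 < q) (hx0 : 0 ≤ x)
    (hx : ENNReal.ofReal x < genPi (q / 2) q / 2) :
    ∃ s, 0 ≤ s ∧ genG (q / (q - 1)) q s = x := by
  have hq0 : 0 < q := by linarith
  obtain ⟨c, hc0, hc1, hc⟩ := exists_lt_genF_of_lt_genPi hq0 hx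
  rw [← genG_conj_eq_genF hq hc0 hc1] at hc
  have hy : 0 ≤ c * (1 - c ^ q) ^ (-(1 / q)) :=
    mul_nonneg hc0 (Real.rpow_nonneg (sub_nonneg.2 (Real.rpow_le_one hc0 hc1.le hq0.le)) _)
  have hcont : Continuous fun y => ∫ t in (0:ℝ)..y, (1 + |t| ^ q) ^ (-(1 / (q / (q - 1)))) :=
    continuous_iff_continuousAt.2 fun y =>
      (hasStrictDerivAt_integral_one_add_abs_rpow hq0 _ y).hasDerivAt.continuousAt
  rw [genG_eq_integral_abs _ q hy] at hc
  obtain ⟨s, hs, hsx⟩ := intermediate_value_Icc hy hcont.continuousOn ⟨by simpa using hx0, hc.le⟩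
  exact ⟨s, hs.1, (genG_eq_integral_abs _ q hs.1).trans hsx⟩

/-- for `1 < q < ∞`, `q* = q/(q-1)` and `x ∈ [0, π_{q/2,q}/2)`,
`cosh_{2,q}(2^(2/q) x) = (cosh_{q*,q} x)^(q*) + (sinh_{q*,q} x)^q`. -/
theorem multiple_angle_cosh2 (q qs : ℝ) (hq : 1 < q) (hqs : qs = q / (q - 1))
    (x : ℝ) (hx0 : 0 ≤ x) (hx : ENNReal.ofReal x < genPi (q / 2) q / 2) :
    gcosh 2 q ((2:ℝ) ^ (2 / q) * x) =
      gcosh qs q x ^ qs + gsinh qs q x ^ q := by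
  have hq0 : 0 < q := by linarith
  have hqs0 : 0 < qs := hqs ▸ div_pos hq0 (by linarith)
  obtain ⟨s, hs, rfl⟩ := exists_genG_conj_eq hq hx0 hx
  have hsq : 0 < 1 + s ^ q := by positivity
  have hpos : 0 ≤ 1 + 2 * s ^ q := by positivity
  rw [← genG_two_eq hq hs, ← hqs, gcosh_genG 2 hq0 (by positivity), gcosh_genG qs hq0 hs,
    gsinh_genG qs hq0 hs, ← Real.rpow_mul hsq.le, one_div_mul_cancel hqs0.ne', Real.rpow_one]
  have hdouble : 1 + ((2:ℝ) ^ (2 / q) * (s * (1 + s ^ q) ^ (1 / q))) ^ q =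
      (1 + 2 * s ^ q) ^ (2 : ℝ) := by
    rw [Real.mul_rpow (by positivity) (by positivity), Real.mul_rpow hs (by positivity),
      ← Real.rpow_mul (by norm_num), div_mul_cancel₀ _ hq0.ne', ← Real.rpow_mul hsq.le,
      one_div_mul_cancel hq0.ne', Real.rpow_one, Real.rpow_two, Real.rpow_two]
    ring
  rw [hdouble, ← Real.rpow_mul hpos, show (2:ℝ) * (1 / 2) = 1 by norm_num, Real.rpow_one]
  ring
end

section
/- Let 1 < q < ∞. Then for all x ∈ [0, π_{q/2,q}/2), sin_{2q/(q+2),q}(2^{2/q} x) = 2^{2/q} · sin_{q/2,q}(x) / (1 + (sin_{q/2,q}(x))^q)^{2/q}. -/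
open MeasureTheory Set
open scoped ENNReal

lemma abs_rpow_lt_one {q t : ℝ} (hq : 0 < q) (ht : |t| < 1) : |t ^ q| < 1 :=
  (Real.abs_rpow_le_abs_rpow t q).trans_lt (Real.rpow_lt_one (abs_nonneg t) ht hq)

lemma one_sub_rpow_pos {q t : ℝ} (hq : 0 < q) (ht : |t| < 1) : 0 < 1 - t ^ q := by
  linarith [(abs_lt.1 (abs_rpow_lt_one hq ht)).2]

lemma continuousOn_genF_integrand (p : ℝ) {q : ℝ} (hq : 0 < q) :
    ContinuousOn (fun t : ℝ => (1 - t ^ q) ^ (-(1 / p))) (Ioo (-1) 1) := by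
  intro t ht
  have h : ContinuousAt (fun t : ℝ => 1 - t ^ q) t :=
    continuousAt_const.sub (Real.continuousAt_rpow_const t q (Or.inr hq.le))
  exact (h.rpow_const (Or.inl (one_sub_rpow_pos hq (abs_lt.2 ht)).ne')).continuousWithinAt

lemma intervalIntegrable_genF_integrand (p : ℝ) {q y : ℝ} (hq : 0 < q) (hy : |y| < 1) :
    IntervalIntegrable (fun t : ℝ => (1 - t ^ q) ^ (-(1 / p))) volume 0 y := by
  refine ((continuousOn_genF_integrand p hq).mono ?_).intervalIntegrable
  exact ordConnected_Ioo.uIcc_subset (by norm_num) (abs_lt.1 hy)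

lemma hasDerivAt_genF (p : ℝ) {q y : ℝ} (hq : 0 < q) (hy : |y| < 1) :
    HasDerivAt (genF p q) ((1 - y ^ q) ^ (-(1 / p))) y := by
  have hc := continuousOn_genF_integrand p hq
  have hmem : Ioo (-1 : ℝ) 1 ∈ nhds y := Ioo_mem_nhds (abs_lt.1 hy).1 (abs_lt.1 hy).2
  exact intervalIntegral.integral_hasDerivAt_right (intervalIntegrable_genF_integrand p hq hy)
    (hc.stronglyMeasurableAtFilter isOpen_Ioo y (abs_lt.1 hy)) (hc.continuousAt hmem)

lemma abs_lt_one_of_mem_Ico {y : ℝ} (hy : y ∈ Ico (0:ℝ) 1) : |y| < 1 := by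
  rw [abs_of_nonneg hy.1]; exact hy.2

lemma continuousOn_genF (p : ℝ) {q : ℝ} (hq : 0 < q) : ContinuousOn (genF p q) (Ico 0 1) :=
  fun _ hy => (hasDerivAt_genF p hq (abs_lt_one_of_mem_Ico hy)).continuousAt.continuousWithinAt

lemma strictMonoOn_genF (p : ℝ) {q : ℝ} (hq : 0 < q) : StrictMonoOn (genF p q) (Ico 0 1) := by
  refine strictMonoOn_of_deriv_pos (convex_Ico 0 1) (continuousOn_genF p hq) fun y hy => ?_
  have hy' := abs_lt_one_of_mem_Ico (interior_subset hy)
  rw [(hasDerivAt_genF p hq hy').deriv]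
  exact Real.rpow_pos_of_pos (one_sub_rpow_pos hq hy') _

lemma gsin_genF (p : ℝ) {q y : ℝ} (hq : 0 < q) (hy : y ∈ Ico (0:ℝ) 1) :
    gsin p q (genF p q y) = y :=
  (strictMonoOn_genF p hq).injOn.leftInvOn_invFunOn hy

lemma ofReal_genF (p : ℝ) {q y : ℝ} (hq : 0 < q) (hy : y ∈ Ico (0:ℝ) 1) :
    ENNReal.ofReal (genF p q y) =
      ∫⁻ t in Ioc (0:ℝ) y, ENNReal.ofReal ((1 - t ^ q) ^ (-(1 / p))) := by
  have hint := intervalIntegrable_genF_integrand p hq (abs_lt_one_of_mem_Ico hy)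
  rw [genF, intervalIntegral.integral_of_le hy.1, ofReal_integral_eq_lintegral_ofReal hint.1]
  refine (ae_restrict_iff' measurableSet_Ioc).2 (.of_forall fun t ht => ?_)
  exact Real.rpow_nonneg
    (one_sub_rpow_pos hq (abs_lt_one_of_mem_Ico ⟨ht.1.le, ht.2.trans_lt hy.2⟩)).le _

lemma genPi_div_two_le (p : ℝ) {q x : ℝ} (hq : 0 < q)
    (h : ∀ y ∈ Ico (0:ℝ) 1, genF p q y ≤ x) : genPi p q / 2 ≤ ENNReal.ofReal x := by
  obtain ⟨u, hu, hu_mem, hu_lim⟩ := exists_seq_strictMono_tendsto' (zero_lt_one' ℝ)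
  have hunion : Ioo (0:ℝ) 1 = ⋃ n, Ioc 0 (u n) := by
    ext t
    simp only [mem_iUnion, mem_Ioc, mem_Ioo]
    constructor
    · rintro ⟨h0, h1⟩
      obtain ⟨n, hn⟩ := (hu_lim.eventually (lt_mem_nhds h1)).exists
      exact ⟨n, h0, hn.le⟩
    · rintro ⟨n, h0, hn⟩
      exact ⟨h0, hn.trans_lt (hu_mem n).2⟩
  have hdir : Directed (· ⊆ ·) fun n => Ioc (0:ℝ) (u n) :=
    Monotone.directed_le fun m n hmn => Ioc_subset_Ioc_right (hu.monotone hmn)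
  rw [genPi, mul_comm, ENNReal.mul_div_cancel_right two_ne_zero ENNReal.ofNat_ne_top, hunion,
    setLIntegral_iUnion_of_directed _ hdir]
  refine iSup_le fun n => ?_
  have hn : u n ∈ Ico (0:ℝ) 1 := ⟨(hu_mem n).1.le, (hu_mem n).2⟩
  rw [← ofReal_genF p hq hn]
  exact ENNReal.ofReal_le_ofReal (h _ hn)

lemma exists_genF_eq (p : ℝ) {q x : ℝ} (hq : 0 < q) (hx0 : 0 ≤ x)
    (hx : ENNReal.ofReal x < genPi p q / 2) : ∃ y ∈ Ico (0:ℝ) 1, genF p q y = x := by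
  obtain ⟨y, hy, hxy⟩ : ∃ y ∈ Ico (0:ℝ) 1, x < genF p q y := by
    by_contra! h
    exact hx.not_ge (genPi_div_two_le p hq h)
  have hsub : Icc 0 y ⊆ Ico (0:ℝ) 1 := fun t ht => ⟨ht.1, ht.2.trans_lt hy.2⟩
  have h0 : genF p q 0 = 0 := by simp [genF]
  obtain ⟨s, hs, hsx⟩ := intermediate_value_Icc hy.1 ((continuousOn_genF p hq).mono hsub)
    (show x ∈ Icc (genF p q 0) (genF p q y) from ⟨h0.le.trans hx0, hxy.le⟩)
  exact ⟨s, hsub hs, hsx⟩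

/-- The substitution `s ↦ 2^(2/q) s / (1 + s^q)^(2/q)` behind the multiple-angle formula. -/
noncomputable def doubleAngleMap (q s : ℝ) : ℝ := (2:ℝ) ^ (2 / q) * s / (1 + s ^ q) ^ (2 / q)

lemma one_sub_doubleAngleMap_rpow {q s : ℝ} (hq : 0 < q) (hs : 0 ≤ s) :
    1 - doubleAngleMap q s ^ q = ((1 - s ^ q) / (1 + s ^ q)) ^ 2 := by
  have hu : 0 ≤ s ^ q := Real.rpow_nonneg hs q
  have hq2 : 2 / q * q = 2 := by field_simp
  rw [doubleAngleMap, Real.div_rpow (by positivity) (by positivity),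
    Real.mul_rpow (by positivity) hs, ← Real.rpow_mul (by norm_num),
    ← Real.rpow_mul (by positivity), hq2, Real.rpow_two, Real.rpow_two]
  field_simp
  ring

lemma doubleAngleMap_mem_Ico {q s : ℝ} (hq : 0 < q) (hs : s ∈ Ico (0:ℝ) 1) :
    doubleAngleMap q s ∈ Ico (0:ℝ) 1 := by
  have hs0 := hs.1
  have hu : 0 ≤ s ^ q := Real.rpow_nonneg hs.1 q
  have hu1 := one_sub_rpow_pos hq (abs_lt_one_of_mem_Ico hs)
  have h0 : 0 ≤ doubleAngleMap q s := by unfold doubleAngleMap; positivity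
  refine ⟨h0, (Real.rpow_lt_rpow_iff h0 zero_le_one hq).1 ?_⟩
  rw [Real.one_rpow]
  have : 0 < ((1 - s ^ q) / (1 + s ^ q)) ^ 2 := by positivity
  linarith [one_sub_doubleAngleMap_rpow hq hs.1]

lemma hasDerivAt_doubleAngleMap {q s : ℝ} (hq : 1 < q) (hs : 0 ≤ s) :
    HasDerivAt (doubleAngleMap q)
      ((2:ℝ) ^ (2 / q) * (1 + s ^ q) ^ (-(2 / q)) * ((1 - s ^ q) / (1 + s ^ q))) s := by
  have hu : 0 ≤ s ^ q := Real.rpow_nonneg hs q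
  have hu' : 0 < 1 + s ^ q := by positivity
  have hpow : HasDerivAt (fun t : ℝ => 1 + t ^ q) (q * s ^ (q - 1)) s :=
    (Real.hasDerivAt_rpow_const (Or.inr hq.le)).const_add 1
  have hmul : s * s ^ (q - 1) = s ^ q := by
    rw [← Real.rpow_one_add' hs (by linarith), add_sub_cancel]
  have hden := hpow.rpow_const (p := -(2 / q)) (Or.inl hu'.ne')
  have hmain := ((hasDerivAt_id s).const_mul ((2:ℝ) ^ (2 / q))).mul hden
  refine (hmain.congr_of_eventuallyEq ?_).congr_deriv ?_
  · have hev := hpow.continuousAt.eventually (lt_mem_nhds hu')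
    filter_upwards [hev] with t ht
    simp only [doubleAngleMap, id, Pi.mul_apply]
    rw [Real.rpow_neg ht.le, div_eq_mul_inv]
  · rw [Real.rpow_sub_one hu'.ne']
    have hq0 : q ≠ 0 := by linarith
    simp only [id]
    field_simp
    linear_combination (-2) * hmul

lemma genF_integrand_doubleAngleMap {q s : ℝ} (hq : 0 < q) (hs : s ∈ Ico (0:ℝ) 1) :
    (1 - doubleAngleMap q s ^ q) ^ (-(1 / (2 * q / (q + 2)))) *
      ((2:ℝ) ^ (2 / q) * (1 + s ^ q) ^ (-(2 / q)) * ((1 - s ^ q) / (1 + s ^ q))) =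
    (2:ℝ) ^ (2 / q) * (1 - s ^ q) ^ (-(1 / (q / 2))) := by
  have hu : 0 ≤ s ^ q := Real.rpow_nonneg hs.1 q
  have hu' : 0 < 1 + s ^ q := by positivity
  have hv := one_sub_rpow_pos hq (abs_lt_one_of_mem_Ico hs)
  have hw : 0 < (1 - s ^ q) / (1 + s ^ q) := by positivity
  have hexp : (2:ℝ) * (-(1 / (2 * q / (q + 2)))) = -(2 / q) - 1 := by field_simp; ring
  have hexp' : -(1 / (q / 2)) = -(2 / q) := by field_simp
  rw [one_sub_doubleAngleMap_rpow hq hs.1, ← Real.rpow_two, ← Real.rpow_mul hw.le, hexp, hexp',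
    Real.rpow_sub_one hw.ne', Real.div_rpow hv.le hu'.le]
  have := (Real.rpow_pos_of_pos hu' (-(2 / q))).ne'
  field_simp

lemma genF_doubleAngleMap {q s : ℝ} (hq : 1 < q) (hs : s ∈ Ico (0:ℝ) 1) :
    genF (2 * q / (q + 2)) q (doubleAngleMap q s) = (2:ℝ) ^ (2 / q) * genF (q / 2) q s := by
  have hq0 : 0 < q := by linarith
  have hderiv : ∀ t ∈ Icc 0 s, HasDerivAt (fun t => genF (2 * q / (q + 2)) q (doubleAngleMap q t) -
      (2:ℝ) ^ (2 / q) * genF (q / 2) q t) 0 t := by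
    intro t ht
    have ht' : t ∈ Ico (0:ℝ) 1 := ⟨ht.1, ht.2.trans_lt hs.2⟩
    have h1 := (hasDerivAt_genF (2 * q / (q + 2)) hq0
      (abs_lt_one_of_mem_Ico (doubleAngleMap_mem_Ico hq0 ht'))).comp t
      (hasDerivAt_doubleAngleMap hq ht'.1)
    have h2 := (hasDerivAt_genF (q / 2) hq0 (abs_lt_one_of_mem_Ico ht')).const_mul
      ((2:ℝ) ^ (2 / q))
    exact (h1.sub h2).congr_deriv (sub_eq_zero.2 (genF_integrand_doubleAngleMap hq0 ht'))
  have hconst := constant_of_has_deriv_right_zero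
    (fun t ht => (hderiv t ht).continuousAt.continuousWithinAt)
    (fun t ht => (hderiv t ⟨ht.1, ht.2.le⟩).hasDerivWithinAt) s ⟨hs.1, le_rfl⟩
  have h0 : doubleAngleMap q 0 = 0 := by simp [doubleAngleMap]
  have hF0 : ∀ p, genF p q 0 = 0 := fun p => by simp [genF]
  simpa only [h0, hF0, mul_zero, sub_zero, sub_eq_zero] using hconst

/-- for `1 < q < ∞` and `x ∈ [0, π_{q/2,q}/2)`,
`sin_{2q/(q+2),q}(2^(2/q) x) = 2^(2/q) · sin_{q/2,q} x / (1 + (sin_{q/2,q} x)^q)^(2/q)`. -/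
theorem multiple_angle_sin2 (q : ℝ) (hq : 1 < q)
    (x : ℝ) (hx0 : 0 ≤ x) (hx : ENNReal.ofReal x < genPi (q / 2) q / 2) :
    gsin (2 * q / (q + 2)) q ((2:ℝ) ^ (2 / q) * x) =
      (2:ℝ) ^ (2 / q) * gsin (q / 2) q x / (1 + gsin (q / 2) q x ^ q) ^ (2 / q) := by
  have hq0 : 0 < q := by linarith
  obtain ⟨s, hs, rfl⟩ := exists_genF_eq (q / 2) hq0 hx0 hx
  rw [gsin_genF _ hq0 hs, ← genF_doubleAngleMap hq hs,
    gsin_genF _ hq0 (doubleAngleMap_mem_Ico hq0 hs), doubleAngleMap]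
end

section
/- For all x ∈ [0, π_{3/2,6}/4), sinh_{2,6}(2x) = 2 · sinh_{2,6}(x) · cosh_{2,6}(x) / √(1 − 8 (sinh_{2,6}(x))^6), and cosh_{2,6}(2x) = (1 + 20 (sinh_{2,6}(x))^6 − 8 (sinh_{2,6}(x))^{12}) / (1 − 8 (sinh_{2,6}(x))^6)^{3/2}. -/
open MeasureTheory Set
open scoped ENNReal

/-- The generalized π, `π_{p,q} = 2∫_0^1 (1 - t^q)^(-1/p) dt`, as a real number
(valid for `p > 1`, where the integral converges). -/
noncomputable def genPiR (p q : ℝ) : ℝ := 2 * ∫ t in (0:ℝ)..1, (1 - t ^ q) ^ (-(1 / p))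

theorem genG_integrand (t : ℝ) : (1 + t ^ (6:ℝ)) ^ (-(1 / (2:ℝ))) = (√(1 + t ^ 6))⁻¹ := by
  have ht : t ^ (6:ℝ) = t ^ 6 := by exact_mod_cast Real.rpow_natCast t 6
  rw [ht, Real.rpow_neg (by positivity), Real.sqrt_eq_rpow]

theorem genG_two_six (y : ℝ) : genG 2 6 y = ∫ t in (0:ℝ)..y, (√(1 + t ^ 6))⁻¹ := by
  simp only [genG, genG_integrand]

theorem continuous_inv_sqrt_one_add_pow_six : Continuous fun t : ℝ => (√(1 + t ^ 6))⁻¹ :=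
  Continuous.inv₀ (by fun_prop) fun t => by positivity

theorem hasStrictDerivAt_genG_two_six (y : ℝ) :
    HasStrictDerivAt (genG 2 6) (√(1 + y ^ 6))⁻¹ y := by
  have h := continuous_inv_sqrt_one_add_pow_six
  have hG : genG 2 6 = fun y => ∫ t in (0:ℝ)..y, (√(1 + t ^ 6))⁻¹ := funext genG_two_six
  rw [hG]
  exact intervalIntegral.integral_hasStrictDerivAt_right (h.intervalIntegrable _ _)
    (h.stronglyMeasurableAtFilter _ _) h.continuousAt

theorem genG_two_six_zero : genG 2 6 0 = 0 := by simp [genG]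

theorem continuous_genG_two_six : Continuous (genG 2 6) :=
  continuous_iff_continuousAt.2 fun y => (hasStrictDerivAt_genG_two_six y).hasDerivAt.continuousAt

theorem strictMono_genG_two_six : StrictMono (genG 2 6) :=
  strictMono_of_deriv_pos fun y => by
    rw [(hasStrictDerivAt_genG_two_six y).hasDerivAt.deriv]; positivity

theorem gsinh_genG_two_six {s : ℝ} (hs : 0 ≤ s) : gsinh 2 6 (genG 2 6 s) = s :=
  strictMono_genG_two_six.injective.injOn.leftInvOn_invFunOn hs

theorem gcosh_genG_two_six {s : ℝ} (hs : 0 ≤ s) : gcosh 2 6 (genG 2 6 s) = √(1 + s ^ 6) := by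
  have hd := hasStrictDerivAt_genG_two_six s
  have hne : (√(1 + s ^ 6))⁻¹ ≠ 0 := by positivity
  have hx : genG 2 6 s ∈ Ici (0:ℝ) := by
    have := strictMono_genG_two_six.monotone hs
    rwa [genG_two_six_zero] at this
  have hL := (hd.to_localInverse hne).hasDerivAt.hasDerivWithinAt (s := Ici (0:ℝ))
  rw [inv_inv] at hL
  have hr := (hd.hasStrictFDerivAt_equiv hne).eventually_right_inverse
  have hev : gsinh 2 6 =ᶠ[nhdsWithin (genG 2 6 s) (Ici 0)] hd.localInverse _ _ _ hne := by
    filter_upwards [hr.filter_mono nhdsWithin_le_nhds, self_mem_nhdsWithin] with z hz hz0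
    have hz' : genG 2 6 (hd.localInverse _ _ _ hne z) = z := hz
    have h0 : 0 ≤ hd.localInverse _ _ _ hne z := by
      rw [← strictMono_genG_two_six.le_iff_le, genG_two_six_zero, hz']; exact hz0
    conv_lhs => rw [← hz']
    exact gsinh_genG_two_six h0
  exact (hL.congr_of_eventuallyEq_of_mem hev hx).derivWithin (uniqueDiffOn_Ici 0 _ hx)

theorem one_add_double_pow_six {s : ℝ} (hs : 8 * s ^ 6 < 1) :
    1 + (2 * s * √(1 + s ^ 6) / √(1 - 8 * s ^ 6)) ^ 6 =
      ((1 + 20 * s ^ 6 - 8 * s ^ 12) / √(1 - 8 * s ^ 6) ^ 3) ^ 2 := by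
  have h1 : √(1 + s ^ 6) ^ 6 = (1 + s ^ 6) ^ 3 := by
    rw [pow_mul √(1 + s ^ 6) 2 3, Real.sq_sqrt (by positivity)]
  have h2 : √(1 - 8 * s ^ 6) ^ 6 = (1 - 8 * s ^ 6) ^ 3 := by
    rw [pow_mul √(1 - 8 * s ^ 6) 2 3, Real.sq_sqrt (by linarith)]
  have h3 : 1 - 8 * s ^ 6 ≠ 0 := by linarith
  rw [div_pow, div_pow, ← pow_mul, mul_pow, h1, h2,
    eq_div_iff (pow_ne_zero 3 h3), add_mul, div_mul_cancel₀ _ (pow_ne_zero 3 h3)]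
  ring

theorem sqrt_one_add_double_pow_six {s : ℝ} (hs : 8 * s ^ 6 < 1) :
    √(1 + (2 * s * √(1 + s ^ 6) / √(1 - 8 * s ^ 6)) ^ 6) =
      (1 + 20 * s ^ 6 - 8 * s ^ 12) / √(1 - 8 * s ^ 6) ^ 3 := by
  rw [one_add_double_pow_six hs]
  refine Real.sqrt_sq (div_nonneg ?_ (by positivity))
  have : 0 ≤ s ^ 6 := by positivity
  nlinarith

theorem hasDerivAt_double {s : ℝ} (hs : 8 * s ^ 6 < 1) :
    HasDerivAt (fun s : ℝ => 2 * s * √(1 + s ^ 6) / √(1 - 8 * s ^ 6))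
      (2 * (1 + 20 * s ^ 6 - 8 * s ^ 12) / (√(1 + s ^ 6) * √(1 - 8 * s ^ 6) ^ 3)) s := by
  have hp : 0 < 1 + s ^ 6 := by positivity
  have hq : 0 < 1 - 8 * s ^ 6 := by linarith
  have h1 : HasDerivAt (fun s : ℝ => √(1 + s ^ 6)) _ s :=
    (((hasDerivAt_pow 6 s).const_add 1)).sqrt hp.ne'
  have h2 : HasDerivAt (fun s : ℝ => √(1 - 8 * s ^ 6)) _ s :=
    ((((hasDerivAt_pow 6 s).const_mul 8).const_sub 1)).sqrt hq.ne'
  have h3 : HasDerivAt (fun s : ℝ => 2 * s * √(1 + s ^ 6)) _ s :=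
    ((hasDerivAt_id' s).const_mul 2).mul h1
  refine (h3.div h2 (Real.sqrt_pos.2 hq).ne').congr_deriv ?_
  have e1 : √(1 + s ^ 6) ^ 2 = 1 + s ^ 6 := Real.sq_sqrt hp.le
  have e2 : √(1 - 8 * s ^ 6) ^ 2 = 1 - 8 * s ^ 6 := Real.sq_sqrt hq.le
  have p1 := Real.sqrt_pos.2 hp
  have p2 := Real.sqrt_pos.2 hq
  generalize √(1 + s ^ 6) = a at *
  generalize √(1 - 8 * s ^ 6) = b at *
  field_simp
  simp only [e1, e2]
  push_cast
  ring

theorem genG_two_six_double {s : ℝ} (hs0 : 0 ≤ s) (hs : 8 * s ^ 6 < 1) :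
    genG 2 6 (2 * s * √(1 + s ^ 6) / √(1 - 8 * s ^ 6)) = 2 * genG 2 6 s := by
  have key : ∀ t ∈ uIcc 0 s, HasDerivAt
      (fun s : ℝ => genG 2 6 (2 * s * √(1 + s ^ 6) / √(1 - 8 * s ^ 6)))
      (2 * (√(1 + t ^ 6))⁻¹) t := by
    intro t ht
    rw [uIcc_of_le hs0] at ht
    have ht1 : 8 * t ^ 6 < 1 := by
      have := pow_le_pow_left₀ ht.1 ht.2 6
      linarith
    refine ((hasStrictDerivAt_genG_two_six _).hasDerivAt.comp t
      (hasDerivAt_double ht1)).congr_deriv ?_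
    rw [sqrt_one_add_double_pow_six ht1]
    have hv : 0 < √(1 - 8 * t ^ 6) := Real.sqrt_pos.2 (by linarith)
    have h6 : 0 ≤ t ^ 6 := by positivity
    have hn : 0 < 1 + 20 * t ^ 6 - 8 * t ^ 12 := by nlinarith
    generalize 1 + 20 * t ^ 6 - 8 * t ^ 12 = n at *
    generalize √(1 - 8 * t ^ 6) = v at *
    field_simp
  have := intervalIntegral.integral_eq_sub_of_hasDerivAt key
    ((continuous_inv_sqrt_one_add_pow_six.const_mul 2).intervalIntegrable _ _)
  rw [intervalIntegral.integral_const_mul, ← genG_two_six] at this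
  simpa [genG_two_six_zero] using this.symm

theorem genF_three_halves_six {t : ℝ} (ht0 : 0 ≤ t) (ht : t < 1) :
    genF (3 / 2) 6 t = genG 2 6 (t * (1 - t ^ 6) ^ (-(1 / 6) : ℝ)) := by
  have hpos : ∀ u ∈ uIcc 0 t, 0 < 1 - u ^ 6 := by
    intro u hu
    rw [uIcc_of_le ht0] at hu
    have := pow_lt_one₀ hu.1 (hu.2.trans_lt ht) (n := 6) (by norm_num)
    linarith
  have key : ∀ u ∈ uIcc 0 t, HasDerivAt
      (fun u : ℝ => genG 2 6 (u * (1 - u ^ 6) ^ (-(1 / 6) : ℝ)))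
      ((1 - u ^ 6) ^ (-(1 / (3 / 2)) : ℝ)) u := by
    intro u hu
    have hv := hpos u hu
    have hd : HasDerivAt (fun u : ℝ => u * (1 - u ^ 6) ^ (-(1 / 6) : ℝ))
        ((1 - u ^ 6) ^ (-(7 / 6) : ℝ)) u := by
      have h1 := ((hasDerivAt_pow 6 u).const_sub 1).rpow_const (p := (-(1 / 6) : ℝ))
        (Or.inl hv.ne')
      refine ((hasDerivAt_id' u).mul h1).congr_deriv ?_
      have e : (1 - u ^ 6) ^ (-(1 / 6) : ℝ) = (1 - u ^ 6) * (1 - u ^ 6) ^ (-(7 / 6) : ℝ) := by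
        nth_rewrite 2 [← Real.rpow_one (1 - u ^ 6)]
        rw [← Real.rpow_add hv]
        norm_num
      rw [e, show (-(1 / 6) - 1 : ℝ) = -(7 / 6) by norm_num]
      push_cast
      ring
    refine ((hasStrictDerivAt_genG_two_six _).hasDerivAt.comp u hd).congr_deriv ?_
    have e : 1 + (u * (1 - u ^ 6) ^ (-(1 / 6) : ℝ)) ^ 6 = (1 - u ^ 6)⁻¹ := by
      rw [mul_pow, ← Real.rpow_mul_natCast hv.le]
      norm_num [Real.rpow_neg_one]
      field_simp
      ring
    rw [e, Real.sqrt_inv, inv_inv, Real.sqrt_eq_rpow, ← Real.rpow_add hv]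
    norm_num
  have hint : IntervalIntegrable (fun u : ℝ => (1 - u ^ 6) ^ (-(1 / (3 / 2)) : ℝ)) volume 0 t :=
    ContinuousOn.intervalIntegrable
      (ContinuousOn.rpow_const (by fun_prop) fun u hu => Or.inl (hpos u hu).ne')
  have := intervalIntegral.integral_eq_sub_of_hasDerivAt key hint
  have hpow : ∀ u : ℝ, u ^ (6:ℝ) = u ^ 6 := fun u => by exact_mod_cast Real.rpow_natCast u 6
  simp only [genF, hpow]
  rw [this]
  simp [genG_two_six_zero]

theorem exists_lt_genG_two_six {a : ℝ} (ha0 : 0 ≤ a) (ha : a < genPiR (3 / 2) 6 / 2) :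
    ∃ y, 0 ≤ y ∧ a < genG 2 6 y := by
  have hF : a < genF (3 / 2) 6 1 := by
    have : genPiR (3 / 2) 6 = 2 * genF (3 / 2) 6 1 := rfl
    linarith
  have hint : IntervalIntegrable (fun t : ℝ => (1 - t ^ (6:ℝ)) ^ (-(1 / (3 / 2)) : ℝ))
      volume 0 1 := by
    by_contra h
    rw [genF, intervalIntegral.integral_undef h] at hF
    linarith
  have hc : ContinuousOn (genF (3 / 2) 6) (Icc 0 1) := by
    have := intervalIntegral.continuousOn_primitive_interval' hint left_mem_uIcc
    rwa [uIcc_of_le zero_le_one] at this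
  have hev : ∀ᶠ t in nhdsWithin (1:ℝ) (Ico 0 1), a < genF (3 / 2) 6 t :=
    ((hc 1 (right_mem_Icc.2 zero_le_one)).mono Ico_subset_Icc_self).eventually_const_lt hF
  have : (nhdsWithin (1:ℝ) (Ico 0 1)).NeBot := right_nhdsWithin_Ico_neBot zero_lt_one
  obtain ⟨t, hat, ht⟩ := (hev.and self_mem_nhdsWithin).exists
  have h6 : t ^ 6 ≤ 1 := pow_le_one₀ ht.1 ht.2.le
  exact ⟨_, mul_nonneg ht.1 (Real.rpow_nonneg (by linarith) _),
    genF_three_halves_six ht.1 ht.2 ▸ hat⟩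

theorem eight_mul_pow_six_lt_one {s y : ℝ} (hs0 : 0 ≤ s)
    (h : 2 * genG 2 6 s < genG 2 6 y) : 8 * s ^ 6 < 1 := by
  by_contra! hs
  obtain ⟨c, ⟨hc0, hcs⟩, hc⟩ : ∃ c ∈ Icc 0 s, 8 * c ^ 6 = 1 :=
    intermediate_value_Icc hs0 (f := fun c : ℝ => 8 * c ^ 6) (by fun_prop) ⟨by norm_num, hs⟩
  have hc0' : 0 < c := hc0.lt_of_ne fun h => by norm_num [← h] at hc
  have hev : ∀ᶠ t in nhdsWithin c (Ico 0 c),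
      y ^ 2 * (1 - 8 * t ^ 6) < (2 * t) ^ 2 * (1 + t ^ 6) := by
    refine Filter.Eventually.filter_mono nhdsWithin_le_nhds ?_
    refine ContinuousAt.eventually_lt (by fun_prop) (by fun_prop) ?_
    rw [hc, sub_self, mul_zero]
    positivity
  have : (nhdsWithin c (Ico 0 c)).NeBot := right_nhdsWithin_Ico_neBot hc0'
  obtain ⟨t, hlt, ht⟩ := (hev.and self_mem_nhdsWithin).exists
  have ht1 : 8 * t ^ 6 < 1 := by
    have := pow_lt_pow_left₀ ht.2 ht.1 (n := 6) (by norm_num)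
    linarith
  have hv : 0 < √(1 - 8 * t ^ 6) := Real.sqrt_pos.2 (by linarith)
  have hle : genG 2 6 t ≤ genG 2 6 s := strictMono_genG_two_six.monotone (ht.2.le.trans hcs)
  have hG : genG 2 6 (2 * t * √(1 + t ^ 6) / √(1 - 8 * t ^ 6)) < genG 2 6 y := by
    rw [genG_two_six_double ht.1 ht1]; linarith
  have hy := strictMono_genG_two_six.lt_iff_lt.1 hG
  rw [div_lt_iff₀ hv] at hy
  have := pow_lt_pow_left₀ hy (by have := ht.1; positivity) two_ne_zero
  rw [mul_pow, mul_pow y, Real.sq_sqrt (by positivity), Real.sq_sqrt (by linarith)] at this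
  linarith

/-- double-angle formulas for `sinh_{2,6}` and `cosh_{2,6}` on
`[0, π_{3/2,6}/4)`. -/
theorem double_angle_sinh_two_six (x : ℝ) (hx0 : 0 ≤ x) (hx : x < genPiR (3/2) 6 / 4) :
    gsinh 2 6 (2 * x) =
        2 * gsinh 2 6 x * gcosh 2 6 x / Real.sqrt (1 - 8 * gsinh 2 6 x ^ 6) ∧
      gcosh 2 6 (2 * x) =
        (1 + 20 * gsinh 2 6 x ^ 6 - 8 * gsinh 2 6 x ^ 12) /
          (1 - 8 * gsinh 2 6 x ^ 6) ^ ((3:ℝ) / 2) := by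
  obtain ⟨y, hy0, hy⟩ := exists_lt_genG_two_six (a := 2 * x) (by linarith) (by linarith)
  obtain ⟨s, ⟨hs0, -⟩, rfl⟩ : ∃ s ∈ Icc 0 y, genG 2 6 s = x :=
    intermediate_value_Icc hy0 continuous_genG_two_six.continuousOn
      ⟨by rwa [genG_two_six_zero], by linarith⟩
  have hs := eight_mul_pow_six_lt_one hs0 hy
  have hd : 0 ≤ 2 * s * √(1 + s ^ 6) / √(1 - 8 * s ^ 6) := by positivity
  rw [← genG_two_six_double hs0 hs, gsinh_genG_two_six hd, gcosh_genG_two_six hd,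
    gsinh_genG_two_six hs0, gcosh_genG_two_six hs0, sqrt_one_add_double_pow_six hs]
  refine ⟨rfl, ?_⟩
  rw [Real.sqrt_eq_rpow, ← Real.rpow_mul_natCast (by linarith)]
  norm_num
end

section
/- For all x ∈ [0, π_{3/2,6}/4), sin_{3/2,6}(2x) = 2 · sin_{3/2,6}(x) / (1 + 18 (sin_{3/2,6}(x))^6 − 27 (sin_{3/2,6}(x))^{12})^{1/3}. -/
open MeasureTheory Set
open scoped ENNReal

/-- The integrand of `genF (3/2) 6`, with a natural-number inner exponent. -/
lemma genF_threehalf_six (y : ℝ) :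
    genF (3/2) 6 y = ∫ t in (0:ℝ)..y, (1 - t ^ 6) ^ (-(2/3) : ℝ) := by
  have h : (-(1 / (3/2)) : ℝ) = -(2/3) := by norm_num
  have h6 (t : ℝ) : t ^ (6:ℝ) = t ^ 6 := by exact_mod_cast Real.rpow_natCast t 6
  simp only [genF, h, h6]

lemma one_sub_pow_six_pos {y : ℝ} (h : |y| < 1) : 0 < 1 - y ^ 6 := by
  have : |y| ^ 6 < 1 := pow_lt_one₀ (abs_nonneg y) h (by norm_num)
  rw [(by decide : Even 6).pow_abs] at this
  linarith

lemma continuousOn_integrand_threehalf_six :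
    ContinuousOn (fun t : ℝ => (1 - t ^ 6) ^ (-(2/3) : ℝ)) (Ioo (-1) 1) := by
  refine ContinuousOn.rpow_const (by fun_prop) fun t ht => Or.inl ?_
  exact (one_sub_pow_six_pos (abs_lt.2 ht)).ne'

lemma hasDerivAt_genF_threehalf_six {y : ℝ} (hy : y ∈ Ioo (-1:ℝ) 1) :
    HasDerivAt (genF (3/2) 6) ((1 - y ^ 6) ^ (-(2/3) : ℝ)) y := by
  rw [funext genF_threehalf_six]
  refine intervalIntegral.integral_hasDerivAt_right ?_ ?_ ?_
  · refine (continuousOn_integrand_threehalf_six.mono ?_).intervalIntegrable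
    exact OrdConnected.uIcc_subset ordConnected_Ioo (by norm_num) hy
  · exact continuousOn_integrand_threehalf_six.stronglyMeasurableAtFilter isOpen_Ioo y hy
  · exact continuousOn_integrand_threehalf_six.continuousAt (isOpen_Ioo.mem_nhds hy)

lemma strictMonoOn_genF_threehalf_six : StrictMonoOn (genF (3/2) 6) (Ico 0 1) := by
  have hsub {y : ℝ} (hy : y ∈ Ico (0:ℝ) 1) : y ∈ Ioo (-1:ℝ) 1 := ⟨by linarith [hy.1], hy.2⟩
  refine strictMonoOn_of_deriv_pos (convex_Ico 0 1)
    (fun y hy => (hasDerivAt_genF_threehalf_six (hsub hy)).continuousAt.continuousWithinAt) ?_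
  intro y hy
  have hy' := hsub (interior_subset hy)
  rw [(hasDerivAt_genF_threehalf_six hy').deriv]
  exact Real.rpow_pos_of_pos (one_sub_pow_six_pos (abs_lt.2 hy')) _

lemma gsin_genF_threehalf_six {y : ℝ} (hy : y ∈ Ico (0:ℝ) 1) :
    gsin (3/2) 6 (genF (3/2) 6 y) = y :=
  strictMonoOn_genF_threehalf_six.injOn.leftInvOn_invFunOn hy

lemma continuousOn_genF_threehalf_six
    (h : IntervalIntegrable (fun t : ℝ => (1 - t ^ 6) ^ (-(2/3) : ℝ)) volume 0 1) :
    ContinuousOn (genF (3/2) 6) (Icc 0 1) := by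
  rw [funext genF_threehalf_six]
  have := intervalIntegral.continuousOn_primitive_interval' h left_mem_uIcc
  rwa [uIcc_of_le zero_le_one] at this

/-- The algebraic map expressing `sin_{3/2,6} (2x)` through `sin_{3/2,6} x`. -/
noncomputable def sinDoubling (s : ℝ) : ℝ :=
  2 * s / (1 + 18 * s ^ 6 - 27 * s ^ 12) ^ ((1:ℝ) / 3)

lemma sinDoubling_denom_pos {s : ℝ} (h : s ^ 6 ≤ 1 / 9) : 0 < 1 + 18 * s ^ 6 - 27 * s ^ 12 := by
  have h0 : 0 ≤ s ^ 6 := by positivity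
  nlinarith [mul_nonneg h0 (sub_nonneg.2 h)]

lemma rpow_third_pow_three {x : ℝ} (hx : 0 ≤ x) : (x ^ ((1:ℝ) / 3)) ^ 3 = x := by
  rw [← Real.rpow_mul_natCast hx]
  norm_num

lemma one_sub_sinDoubling_pow_six {s : ℝ} (h : s ^ 6 ≤ 1 / 9) :
    1 - sinDoubling s ^ 6 = (1 - s ^ 6) *
      ((1 - 9 * s ^ 6) / ((1 + 18 * s ^ 6 - 27 * s ^ 12) ^ ((1:ℝ) / 3)) ^ 2) ^ 3 := by
  have hD := sinDoubling_denom_pos h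
  have hc := Real.rpow_pos_of_pos hD ((1:ℝ) / 3)
  have hc3 := rpow_third_pow_three hD.le
  rw [sinDoubling]
  set c := (1 + 18 * s ^ 6 - 27 * s ^ 12) ^ ((1:ℝ) / 3)
  field_simp
  have : c ^ 6 = (1 + 18 * s ^ 6 - 27 * s ^ 12) ^ 2 := by rw [← hc3]; ring
  rw [this]
  ring

lemma sinDoubling_nonneg {s : ℝ} (h0 : 0 ≤ s) (h : s ^ 6 ≤ 1 / 9) : 0 ≤ sinDoubling s :=
  div_nonneg (by linarith) (Real.rpow_nonneg (sinDoubling_denom_pos h).le _)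

lemma sinDoubling_lt_one {s : ℝ} (h : s ^ 6 < 1 / 9) : sinDoubling s < 1 := by
  have hD := sinDoubling_denom_pos h.le
  have hc := Real.rpow_pos_of_pos hD ((1:ℝ) / 3)
  have h1 : 0 < 1 - s ^ 6 := by linarith
  have h2 : 0 < 1 - 9 * s ^ 6 := by linarith
  have h3 : 0 < 1 - sinDoubling s ^ 6 := by
    rw [one_sub_sinDoubling_pow_six h.le]
    positivity
  by_contra! hle
  linarith [one_le_pow₀ hle (n := 6)]

lemma sinDoubling_le_one {s : ℝ} (h : s ^ 6 ≤ 1 / 9) : sinDoubling s ≤ 1 := by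
  have hD := sinDoubling_denom_pos h
  have hc := Real.rpow_pos_of_pos hD ((1:ℝ) / 3)
  have h1 : 0 ≤ 1 - s ^ 6 := by linarith
  have h2 : 0 ≤ 1 - 9 * s ^ 6 := by linarith
  have h3 : 0 ≤ 1 - sinDoubling s ^ 6 := by
    rw [one_sub_sinDoubling_pow_six h]
    positivity
  by_contra! hlt
  linarith [one_lt_pow₀ hlt (n := 6) (by norm_num)]

lemma hasDerivAt_sinDoubling {s : ℝ} (h : s ^ 6 ≤ 1 / 9) :
    HasDerivAt sinDoubling (2 * ((1 - 9 * s ^ 6) /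
      ((1 + 18 * s ^ 6 - 27 * s ^ 12) ^ ((1:ℝ) / 3)) ^ 2) ^ 2) s := by
  have hD := sinDoubling_denom_pos h
  have hc := Real.rpow_pos_of_pos hD ((1:ℝ) / 3)
  have hc3 := rpow_third_pow_three hD.le
  have hpoly : HasDerivAt (fun s : ℝ => 1 + 18 * s ^ 6 - 27 * s ^ 12)
      (18 * (6 * s ^ 5) - 27 * (12 * s ^ 11)) s := by
    have h6 := (hasDerivAt_pow 6 s).const_mul 18
    have h12 := (hasDerivAt_pow 12 s).const_mul 27
    exact (h6.const_add 1).sub h12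
  have hroot := hpoly.rpow_const (p := (1:ℝ) / 3) (Or.inl hD.ne')
  rw [Real.rpow_sub_one hD.ne'] at hroot
  have hquot := ((hasDerivAt_id s).const_mul 2).div hroot hc.ne'
  refine hquot.congr_deriv ?_
  simp only [id_eq]
  set c := (1 + 18 * s ^ 6 - 27 * s ^ 12) ^ ((1:ℝ) / 3)
  have hdiv : c / (1 + 18 * s ^ 6 - 27 * s ^ 12) = 1 / c ^ 2 := by
    rw [← hc3]; field_simp
  rw [hdiv]
  field_simp
  rw [hc3]
  ring

lemma hasDerivAt_genF_sinDoubling {s : ℝ} (h0 : 0 ≤ s) (h : s ^ 6 < 1 / 9) :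
    HasDerivAt (fun s => genF (3/2) 6 (sinDoubling s)) (2 * (1 - s ^ 6) ^ (-(2/3) : ℝ)) s := by
  have hmem : sinDoubling s ∈ Ioo (-1:ℝ) 1 :=
    ⟨by linarith [sinDoubling_nonneg h0 h.le], sinDoubling_lt_one h⟩
  refine ((hasDerivAt_genF_threehalf_six hmem).comp s
    (hasDerivAt_sinDoubling h.le)).congr_deriv ?_
  rw [one_sub_sinDoubling_pow_six h.le]
  have hc := Real.rpow_pos_of_pos (sinDoubling_denom_pos h.le) ((1:ℝ) / 3)
  have h1 : 0 < 1 - s ^ 6 := by linarith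
  have h2 : 0 < 1 - 9 * s ^ 6 := by linarith
  have hr : 0 < (1 - 9 * s ^ 6) / ((1 + 18 * s ^ 6 - 27 * s ^ 12) ^ ((1:ℝ) / 3)) ^ 2 := by
    positivity
  generalize (1 - 9 * s ^ 6) / ((1 + 18 * s ^ 6 - 27 * s ^ 12) ^ ((1:ℝ) / 3)) ^ 2 = r at hr ⊢
  have hpow : (r ^ 3) ^ (-(2/3) : ℝ) = (r ^ 2)⁻¹ := by
    rw [← Real.rpow_natCast_mul hr.le, ← Real.rpow_natCast r 2, ← Real.rpow_neg hr.le]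
    norm_num
  rw [Real.mul_rpow h1.le (by positivity), hpow]
  field_simp

lemma genF_sinDoubling
    (hint : IntervalIntegrable (fun t : ℝ => (1 - t ^ 6) ^ (-(2/3) : ℝ)) volume 0 1)
    {s : ℝ} (h0 : 0 ≤ s) (h : s ^ 6 ≤ 1 / 9) :
    genF (3/2) 6 (sinDoubling s) = 2 * genF (3/2) 6 s := by
  have hF := continuousOn_genF_threehalf_six hint
  have hle {y : ℝ} (hy : y ∈ Icc 0 s) : y ^ 6 ≤ 1 / 9 := (pow_le_pow_left₀ hy.1 hy.2 6).trans h
  have hlt_one {y : ℝ} (hy : y ^ 6 ≤ 1 / 9) : y < 1 := by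
    by_contra! h1
    linarith [one_le_pow₀ h1 (n := 6)]
  have hconst := constant_of_has_deriv_right_zero
    (f := fun y => genF (3/2) 6 (sinDoubling y) - 2 * genF (3/2) 6 y) (a := 0) (b := s) ?_ ?_
    s (right_mem_Icc.2 h0)
  · have hz : genF (3/2) 6 0 = 0 := by simp [genF]
    have hz' : sinDoubling 0 = 0 := by simp [sinDoubling]
    simp only [hz, hz'] at hconst
    linarith
  · refine ContinuousOn.sub (hF.comp ?_ ?_) (continuousOn_const.mul (hF.mono ?_))
    · exact fun y hy => (hasDerivAt_sinDoubling (hle hy)).continuousAt.continuousWithinAt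
    · exact fun y hy => ⟨sinDoubling_nonneg hy.1 (hle hy), sinDoubling_le_one (hle hy)⟩
    · exact fun y hy => ⟨hy.1, (hlt_one (hle hy)).le⟩
  · intro y hy
    have hy6 : y ^ 6 < 1 / 9 := (pow_lt_pow_left₀ hy.2 hy.1 (by norm_num)).trans_le h
    have hyI : y ∈ Ioo (-1:ℝ) 1 := ⟨by linarith [hy.1], hlt_one hy6.le⟩
    refine (((hasDerivAt_genF_sinDoubling hy.1 hy6).sub
      ((hasDerivAt_genF_threehalf_six hyI).const_mul 2)).congr_deriv ?_).hasDerivWithinAt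
    ring

/-- double-angle formula for `sin_{3/2,6}` on `[0, π_{3/2,6}/4)`. -/
theorem double_angle_sin_threehalf_six (x : ℝ) (hx0 : 0 ≤ x)
    (hx : x < genPiR (3/2) 6 / 4) :
    gsin (3/2) 6 (2 * x) =
      2 * gsin (3/2) 6 x /
        (1 + 18 * gsin (3/2) 6 x ^ 6 - 27 * gsin (3/2) 6 x ^ 12) ^ ((1:ℝ) / 3) := by
  have hpi : genPiR (3/2) 6 = 2 * genF (3/2) 6 1 := rfl
  rw [hpi] at hx
  have hint : IntervalIntegrable (fun t : ℝ => (1 - t ^ 6) ^ (-(2/3) : ℝ)) volume 0 1 := by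
    by_contra hn
    rw [genF_threehalf_six, intervalIntegral.integral_undef hn] at hx
    linarith
  obtain ⟨s₀, hs₀, hs₀6⟩ : ∃ s₀ : ℝ, 0 ≤ s₀ ∧ s₀ ^ 6 = 1 / 9 := by
    refine ⟨(1 / 9 : ℝ) ^ ((1:ℝ) / 6), by positivity, ?_⟩
    rw [← Real.rpow_mul_natCast (by norm_num)]
    norm_num
  have hs₀1 : s₀ < 1 := by
    by_contra! h1
    linarith [one_le_pow₀ h1 (n := 6)]
  have hend : sinDoubling s₀ = 1 := by
    have h6 := one_sub_sinDoubling_pow_six hs₀6.le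
    rw [hs₀6] at h6
    refine (pow_eq_one_iff_of_nonneg (sinDoubling_nonneg hs₀ hs₀6.le) (n := 6) (by norm_num)).1 ?_
    norm_num at h6
    linarith
  have hhalf := genF_sinDoubling hint hs₀ hs₀6.le
  rw [hend] at hhalf
  have hcont : ContinuousOn (genF (3/2) 6) (Icc 0 s₀) :=
    (continuousOn_genF_threehalf_six hint).mono (Icc_subset_Icc_right hs₀1.le)
  have hxmem : x ∈ Ico (genF (3/2) 6 0) (genF (3/2) 6 s₀) := by
    refine ⟨?_, by linarith⟩
    simpa [genF] using hx0
  obtain ⟨s, hs, rfl⟩ := intermediate_value_Ico hs₀ hcont hxmem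
  have hs6 : s ^ 6 < 1 / 9 := hs₀6 ▸ pow_lt_pow_left₀ hs.2 hs.1 (by norm_num)
  rw [gsin_genF_threehalf_six ⟨hs.1, hs.2.trans hs₀1⟩, ← genF_sinDoubling hint hs.1 hs6.le,
    gsin_genF_threehalf_six ⟨sinDoubling_nonneg hs.1 hs6.le, sinDoubling_lt_one hs6⟩, sinDoubling]
end
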